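/- Assume p ≥ 7. Then for every s ≥ 1 the coradical H₀ is not isomorphic as a coalgebra to kC_p ⊕ M*(p−2,k)^{sp}. -/

import Mathlib

open TensorProduct

namespace HopfClass

variable (k : Type*) [Field k]

section Wrt

variable {M : Type*} [AddCommGroup M] [Module k M]

/-- A subspace `C` is a subcoalgebra with respect to a comultiplication-like map `Δ`
if `Δ` maps `C` into the image of `C ⊗ C` in `M ⊗ M`. -/
def IsSubcoalgWrt (Δ : M →ₗ[k] M ⊗[k] M) (C : Submodule k M) : Prop :=
  ∀ x ∈ C, Δ x ∈ LinearMap.range (TensorProduct.map C.subtype C.subtype)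

/-- A simple subcoalgebra: a nonzero subcoalgebra with no nonzero proper subcoalgebras. -/
def IsSimpleSubcoalgWrt (Δ : M →ₗ[k] M ⊗[k] M) (C : Submodule k M) : Prop :=
  IsSubcoalgWrt k Δ C ∧ C ≠ ⊥ ∧
    ∀ D : Submodule k M, IsSubcoalgWrt k Δ D → D < C → D = ⊥

/-- Pointedness: every simple subcoalgebra is one-dimensional. -/
def IsPointedWrt (Δ : M →ₗ[k] M ⊗[k] M) : Prop :=
  ∀ C : Submodule k M, IsSimpleSubcoalgWrt k Δ C → Module.finrank k C = 1

/-- Grouplike element with respect to `Δ`. -/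
def IsGrouplikeWrt (Δ : M →ₗ[k] M ⊗[k] M) (g : M) : Prop :=
  g ≠ 0 ∧ Δ g = g ⊗ₜ[k] g

/-- `y` is a `(h, g)`-skew-primitive with respect to `Δ`, i.e. `Δ y = g ⊗ y + y ⊗ h`. -/
def IsSkewPrimitiveWrt (Δ : M →ₗ[k] M ⊗[k] M) (g h y : M) : Prop :=
  Δ y = g ⊗ₜ[k] y + y ⊗ₜ[k] h

/-- There are no nontrivial skew-primitive elements: every skew-primitive between grouplikes
is a scalar multiple of the difference of the grouplikes. -/
def HasNoNontrivialSkewPrimitivesWrt (Δ : M →ₗ[k] M ⊗[k] M) : Prop :=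
  ∀ g h y : M, IsGrouplikeWrt k Δ g → IsGrouplikeWrt k Δ h →
    IsSkewPrimitiveWrt k Δ g h y → ∃ c : k, y = c • (g - h)

end Wrt

section Coalg

variable (H : Type*) [AddCommGroup H] [Module k H] [Coalgebra k H]

/-- The comultiplication of a coalgebra, as a linear map. -/
noncomputable abbrev comulL : H →ₗ[k] H ⊗[k] H := CoalgebraStruct.comul

/-- The coradical of a coalgebra: the sum of all its simple subcoalgebras. -/
noncomputable def coradical : Submodule k H :=
  sSup {C : Submodule k H | IsSimpleSubcoalgWrt k (comulL k H) C}

/-- A coalgebra is cosemisimple if it equals its coradical. -/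
def IsCosemisimple : Prop := coradical k H = ⊤

/-- A coalgebra is pointed if all its simple subcoalgebras are one-dimensional. -/
def IsPointed : Prop := IsPointedWrt k (comulL k H)

/-- The set of grouplike elements. -/
def grouplikes : Set H := {g : H | IsGrouplikeWrt k (comulL k H) g}

/-- `e` is a multiplicative matrix of size `n` spanning the subspace `C`, i.e. a
linearly independent family with `Δ(e i j) = ∑ l, e i l ⊗ e l j` and `ε(e i j) = δ_ij`
whose span is `C`; this says precisely that `C` is a simple matrix subcoalgebra
isomorphic to `M*(n,k)`, the dual of the `n × n` matrix algebra. -/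
def IsMultMatrix (n : ℕ) (C : Submodule k H) (e : Fin n → Fin n → H) : Prop :=
  LinearIndependent k (fun p : Fin n × Fin n => e p.1 p.2) ∧
  C = Submodule.span k (Set.range fun p : Fin n × Fin n => e p.1 p.2) ∧
  (∀ i j, CoalgebraStruct.comul (R := k) (e i j) = ∑ l : Fin n, e i l ⊗ₜ[k] e l j) ∧
  (∀ i j, Coalgebra.counit (R := k) (e i j) = if i = j then (1 : k) else 0)

/-- `C` is a (simple matrix) subcoalgebra isomorphic to the matrix coalgebra `M*(n,k)`. -/
def IsMatrixSubcoalg (n : ℕ) (C : Submodule k H) : Prop :=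
  ∃ e : Fin n → Fin n → H, IsMultMatrix k H n C e

end Coalg

section Dual

variable (H : Type*) [Ring H] [Algebra k H] [FiniteDimensional k H]

/-- The comultiplication on the dual of a finite-dimensional algebra:
the dual map of the multiplication, composed with the canonical identification
`(H ⊗ H)* ≃ H* ⊗ H*`. -/
noncomputable def dualComul :
    Module.Dual k H →ₗ[k] Module.Dual k H ⊗[k] Module.Dual k H :=
  (TensorProduct.dualDistribEquiv k H H).symm.toLinearMap ∘ₗ
    (LinearMap.mul' k H).dualMap

/-- A finite-dimensional Hopf algebra is copointed if its dual is pointed. -/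
def IsCopointed : Prop := IsPointedWrt k (dualComul k H)

/-- The grouplike elements of the dual Hopf algebra. -/
def dualGrouplikes : Set (Module.Dual k H) :=
  {f : Module.Dual k H | IsGrouplikeWrt k (dualComul k H) f}

end Dual

section Taft

variable (p : ℕ) (q : k)

/-- `B` is (isomorphic to) the Taft Hopf algebra `T_q` of dimension `p²`: `q` is a primitive
`p`-th root of unity, `B` has dimension `p²` and is generated as an algebra by a grouplike `g`
and a `(1,g)`-skew-primitive `x` with `g^p = 1`, `x^p = 0` and `g x = q x g`. -/
def IsTaftAlgebra (B : Type*) [Ring B] [Bialgebra k B] : Prop :=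
  IsPrimitiveRoot q p ∧ Module.finrank k B = p ^ 2 ∧
  ∃ g x : B,
    IsGrouplikeWrt k (comulL k B) g ∧
    CoalgebraStruct.comul (R := k) x = x ⊗ₜ[k] (1 : B) + g ⊗ₜ[k] x ∧
    g ^ p = 1 ∧ x ^ p = 0 ∧ g * x = q • (x * g) ∧
    Algebra.adjoin k {g, x} = (⊤ : Subalgebra k B)

variable {H : Type*} [Ring H] [Bialgebra k H]

/-- The subalgebra `T` of `H` is a sub-Hopf algebra isomorphic to the Taft algebra `T_q` of
dimension `p²`, generated by a grouplike `g` and a `(1,g)`-skew-primitive `x` satisfying the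
Taft relations. -/
def IsTaftSubalgebra (T : Subalgebra k H) : Prop :=
  IsPrimitiveRoot q p ∧ Module.finrank k T = p ^ 2 ∧
  ∃ g x : H,
    IsGrouplikeWrt k (comulL k H) g ∧
    CoalgebraStruct.comul (R := k) x = x ⊗ₜ[k] (1 : H) + g ⊗ₜ[k] x ∧
    g ^ p = 1 ∧ x ^ p = 0 ∧ g * x = q • (x * g) ∧
    Algebra.adjoin k {g, x} = T

/-- The right coinvariants `H^{co π}` of a linear map `π : H → B` on a bialgebra `H`:
elements `h` with `(id ⊗ π)(Δ h) = h ⊗ 1`. -/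
def rightCoinvariants {B : Type*} [Ring B] [Bialgebra k B] (π : H →ₗ[k] B) : Set H :=
  {h : H | (TensorProduct.map LinearMap.id π) (CoalgebraStruct.comul (R := k) h)
      = h ⊗ₜ[k] (1 : B)}

end Taft

end HopfClass

namespace HopfClass

open WithConv Coalgebra

/-- Elements of the Jacobson radical of an artinian ring are nilpotent. -/
theorem isNilpotent_of_mem_jacobson {A : Type*} [Ring A] [IsArtinianRing A] {x : A}
    (hx : x ∈ Ring.jacobson A) : IsNilpotent x := by
  obtain ⟨m, hm⟩ := IsSemiprimaryRing.isNilpotent (R := A)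
  refine ⟨m, ?_⟩
  have := Ideal.pow_mem_pow hx m
  rw [hm] at this
  simpa using this

section SplitQuotient

variable {k A G I N : Type*} [Field k] [Ring A] [Algebra k A]
  [Fintype G] [DecidableEq G] [Fintype I] [DecidableEq I] [Fintype N] [DecidableEq N]
  (π : A →ₐ[k] (G → k) × (I → Matrix N N k))

/-- A class function on `(G → k) × (I → Matrix N N k)` is a combination of the coordinates of the
first factor and the traces of the second one. -/
theorem classFunction_eq_sum (n₀ : N) (t : (G → k) × (I → Matrix N N k) →ₗ[k] k)
    (ht : ∀ x y, t (x * y) = t (y * x)) (x : (G → k) × (I → Matrix N N k)) :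
    t x = ∑ g, t (Pi.single g 1, 0) * x.1 g +
      ∑ i, t (0, Pi.single i (Matrix.single n₀ n₀ 1)) * (x.2 i).trace := by
  obtain ⟨τ, hτ⟩ : ∃ τ : I → k, ∀ i, t (0, Pi.single i (Matrix.single n₀ n₀ 1)) = τ i :=
    ⟨_, fun _ => rfl⟩
  have hoff : ∀ i a b, t (0, Pi.single i (Matrix.single a b 1)) =
      if a = b then τ i else 0 := by
    intro i a b
    have h := ht (0, Pi.single i (Matrix.single a n₀ 1)) (0, Pi.single i (Matrix.single n₀ b 1))
    simp only [Prod.mk_mul_mk, mul_zero, ← Pi.single_mul] at h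
    rw [Matrix.single_mul_single_same] at h
    rw [mul_one] at h
    rw [h]
    split_ifs with hab
    · subst hab
      rw [Matrix.single_mul_single_same, mul_one, hτ]
    · rw [Matrix.single_mul_single_of_ne (h := fun h => hab h.symm)]
      rw [Pi.single_zero]
      exact map_zero t
  have hx : x = ∑ g, x.1 g • ((Pi.single g 1, 0) : (G → k) × (I → Matrix N N k)) +
      ∑ i, ∑ a, ∑ b, x.2 i a b •
        ((0, Pi.single i (Matrix.single a b 1)) : (G → k) × (I → Matrix N N k)) := by
    refine Prod.ext ?_ ?_
    · simp only [Prod.fst_add, Prod.fst_sum, Prod.smul_fst, smul_zero, Finset.sum_const_zero,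
        add_zero]
      funext g
      simp [Finset.sum_apply, Pi.single_apply]
    · simp only [Prod.snd_add, Prod.snd_sum, Prod.smul_snd, smul_zero, Finset.sum_const_zero,
        zero_add]
      funext i
      rw [Finset.sum_apply, Finset.sum_eq_single i]
      · simp only [Finset.sum_apply, Pi.smul_apply, Pi.single_eq_same]
        conv_lhs => rw [Matrix.matrix_eq_sum_single (x.2 i)]
        simp
      · intro j _ hj
        simp [Finset.sum_apply, Pi.single_eq_of_ne hj.symm]
      · simp
  conv_lhs => rw [hx]
  simp only [map_add, map_sum, map_smul, smul_eq_mul, hoff]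
  congr 1
  · exact Finset.sum_congr rfl fun g _ => mul_comm _ _
  · refine Finset.sum_congr rfl fun i _ => ?_
    simp only [mul_ite, mul_zero, Finset.sum_ite_eq, Finset.mem_univ, if_true, Matrix.trace,
      Matrix.diag_apply, Finset.mul_sum]
    exact Finset.sum_congr rfl fun a _ => mul_comm _ _

variable {π}

/-- A linear form on `A` that is symmetric and vanishes on the kernel of `π` is a combination
of the irreducible characters. -/
theorem symmetric_form_eq_sum (n₀ : N) (hπ : Function.Surjective π) (t : A →ₗ[k] k)
    (ht : ∀ x y, t (x * y) = t (y * x)) (h0 : ∀ x, π x = 0 → t x = 0)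
    {ε : G → A} (hε : ∀ g, π (ε g) = (Pi.single g 1, 0))
    {η : I → A} (hη : ∀ i, π (η i) = (0, Pi.single i (Matrix.single n₀ n₀ 1))) (x : A) :
    t x = ∑ g, t (ε g) * (π x).1 g + ∑ i, t (η i) * ((π x).2 i).trace := by
  obtain ⟨s, hs⟩ := π.toLinearMap.exists_rightInverse_of_surjective
    (LinearMap.range_eq_top.2 hπ)
  have hs' : ∀ y, π (s y) = y := fun y => LinearMap.congr_fun hs y
  have hts : ∀ x, t (s (π x)) = t x := fun x => by
    have := h0 (s (π x) - x) (by rw [map_sub, hs', sub_self])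
    rwa [map_sub, sub_eq_zero] at this
  have key := classFunction_eq_sum n₀ (t ∘ₗ s) (fun x y => by
    have e : ∀ x y, t (s (x * y)) = t (s x * s y) := fun x y => by
      rw [← hts (s x * s y), map_mul π, hs', hs']
    simp only [LinearMap.comp_apply, e, ht]) (π x)
  simpa [← hε, ← hη, hts] using key

/-- The trace of an idempotent endomorphism is its rank. -/
theorem trace_idempotent {M : Type*} [AddCommGroup M] [Module k M] [FiniteDimensional k M]
    {e : Module.End k M} (he : IsIdempotentElem e) :
    LinearMap.trace k M e = Module.finrank k (LinearMap.range e) := by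
  have hp : LinearMap.IsProj (LinearMap.range e) e := LinearMap.IsIdempotentElem.isProj_range e he
  exact hp.trace

theorem trace_decomposition [FiniteDimensional k A] (n₀ : N) (hπ : Function.Surjective π)
    (hker : ∀ x, π x = 0 → x ∈ Ring.jacobson A)
    {ε : G → A} (hε : ∀ g, π (ε g) = (Pi.single g 1, 0)) (hεi : ∀ g, IsIdempotentElem (ε g))
    {η : I → A} (hη : ∀ i, π (η i) = (0, Pi.single i (Matrix.single n₀ n₀ 1)))
    (hηi : ∀ i, IsIdempotentElem (η i))
    {M : Type*} [AddCommGroup M] [Module k M] [FiniteDimensional k M]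
    (ρ : A →ₐ[k] Module.End k M) (x : A) :
    LinearMap.trace k M (ρ x) =
      ∑ g, (Module.finrank k (LinearMap.range (ρ (ε g))) : k) * (π x).1 g +
      ∑ i, (Module.finrank k (LinearMap.range (ρ (η i))) : k) * ((π x).2 i).trace := by
  have : IsArtinianRing A := IsArtinianRing.of_finite k A
  have := symmetric_form_eq_sum n₀ hπ (LinearMap.trace k M ∘ₗ ρ.toLinearMap)
    (fun x y => by simp [LinearMap.trace_mul_comm k (ρ x)])
    (fun x hx => by
      have := LinearMap.isNilpotent_trace_of_isNilpotent
        ((isNilpotent_of_mem_jacobson (hker x hx)).map ρ)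
      simpa using this.eq_zero) hε hη x
  simp only [LinearMap.comp_apply, AlgHom.toLinearMap_apply] at this
  rw [this]
  simp only [trace_idempotent ((hεi _).map ρ), trace_idempotent ((hηi _).map ρ)]

omit [Fintype G] [DecidableEq G] [Fintype I] [DecidableEq I] in
theorem exists_idempotent_lift [FiniteDimensional k A] (hπ : Function.Surjective π)
    (hker : ∀ x, π x = 0 → x ∈ Ring.jacobson A) {y : (G → k) × (I → Matrix N N k)}
    (hy : IsIdempotentElem y) : ∃ e : A, IsIdempotentElem e ∧ π e = y :=
  have : IsArtinianRing A := IsArtinianRing.of_finite k A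
  exists_isIdempotentElem_eq_of_ker_isNilpotent (π : A →+* (G → k) × (I → Matrix N N k))
    (fun x hx => isNilpotent_of_mem_jacobson (hker x hx)) y (hπ y) hy

end SplitQuotient

/-- The dual algebra of a coalgebra, with the convolution product. -/
abbrev ConvDual (k H : Type*) [Field k] [AddCommGroup H] [Module k H] := WithConv (H →ₗ[k] k)

section Coalgebra

variable {k H : Type*} [Field k] [AddCommGroup H] [Module k H]

theorem convDual_ext {x y : H} (h : ∀ f : ConvDual k H, f x = f y) : x = y := by
  rw [← sub_eq_zero]
  refine (Module.forall_dual_apply_eq_zero_iff k _).1 fun f => ?_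
  rw [map_sub, sub_eq_zero]
  exact h (toConv f)

variable [Coalgebra k H]

theorem convDual_mul_apply_tmul (f g : ConvDual k H) (h : H) :
    (f * g) h = LinearMap.mul' k k (TensorProduct.map f.ofConv g.ofConv (comul h)) := rfl

/-- A square matrix over a coalgebra with `Δ X = X ⊗ X` and `ε X = 1`. -/
structure IsMultiplicative {ι : Type*} [Fintype ι] [DecidableEq ι] (X : ι → ι → H) : Prop where
  comul_eq : ∀ i j, comul (R := k) (X i j) = ∑ l, X i l ⊗ₜ[k] X l j
  counit_eq : ∀ i j, counit (R := k) (X i j) = if i = j then (1 : k) else 0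

variable {ι : Type*} [Fintype ι] [DecidableEq ι] {X : ι → ι → H}

/-- The matrix representation of the dual algebra attached to a multiplicative matrix. -/
noncomputable def matrixRep (X : ι → ι → H) (hX : IsMultiplicative (k := k) X) :
    ConvDual k H →ₐ[k] Matrix ι ι k :=
  AlgHom.ofLinearMap
    { toFun := fun f => Matrix.of fun i j => f (X i j)
      map_add' := fun f g => by ext; simp
      map_smul' := fun c f => by ext; simp }
    (by
      ext i j
      simp [hX.counit_eq, Matrix.one_apply])
    (fun f g => by
      ext i j
      simp [hX.comul_eq, Matrix.mul_apply])

@[simp] theorem matrixRep_apply (hX : IsMultiplicative (k := k) X) (f : ConvDual k H) (i j : ι) :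
    matrixRep X hX f i j = f (X i j) := rfl

/-- The evaluation of the dual algebra at a grouplike element. -/
noncomputable def evalGroupLike (g : GroupLike k H) : ConvDual k H →ₐ[k] k :=
  AlgHom.ofLinearMap
    (LinearMap.applyₗ (g : H) ∘ₗ (WithConv.linearEquiv k (H →ₗ[k] k)).toLinearMap)
    (by simp [g.2.counit_eq_one])
    (fun f f' => by simp [g.2.comul_eq_tmul_self])

@[simp] theorem evalGroupLike_apply (g : GroupLike k H) (f : ConvDual k H) :
    evalGroupLike g f = f (g : H) := rfl

/-- The operator `h ↦ h₁ f(h₂)`. -/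
noncomputable def rightHitL : ConvDual k H →ₗ[k] Module.End k H where
  toFun f := (TensorProduct.rid k H).toLinearMap ∘ₗ LinearMap.lTensor H f.ofConv ∘ₗ comul
  map_add' f g := by ext; simp [LinearMap.lTensor_add]
  map_smul' c f := by ext; simp [LinearMap.lTensor_smul]

theorem rightHitL_repr (f : ConvDual k H) {h : H} {ι : Type*} (r : Coalgebra.Repr k h ι) :
    rightHitL f h = ∑ i ∈ r.index, f (r.right i) • r.left i := by
  simp [rightHitL, ← r.eq]

theorem apply_rightHitL (f g : ConvDual k H) (h : H) : f (rightHitL g h) = (f * g) h := by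
  rw [rightHitL_repr g (ℛ k h), (ℛ k h).convMul_apply]
  simp [mul_comm]

variable (k H) in
/-- The action `h ↦ h₁ f(h₂)` of the dual algebra on the coalgebra. -/
noncomputable def rightHit : ConvDual k H →ₐ[k] Module.End k H :=
  AlgHom.ofLinearMap rightHitL
    (by
      ext h
      exact convDual_ext (k := k) fun f => by rw [apply_rightHitL, mul_one]; rfl)
    (fun f g => by
      ext h
      exact convDual_ext (k := k) fun f' => by
        rw [Module.End.mul_apply, apply_rightHitL, apply_rightHitL, apply_rightHitL, mul_assoc])

theorem rightHit_repr (f : ConvDual k H) {h : H} {ι : Type*} (r : Coalgebra.Repr k h ι) :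
    rightHit k H f h = ∑ i ∈ r.index, f (r.right i) • r.left i := rightHitL_repr f r

theorem apply_rightHit (f g : ConvDual k H) (h : H) : f (rightHit k H g h) = (f * g) h :=
  apply_rightHitL f g h

/-- The operator `h ↦ f(h₁) h₂`. -/
noncomputable def leftHit (f : ConvDual k H) : Module.End k H :=
  (TensorProduct.lid k H).toLinearMap ∘ₗ LinearMap.rTensor H f.ofConv ∘ₗ comul

theorem leftHit_repr (f : ConvDual k H) {h : H} {ι : Type*} (r : Coalgebra.Repr k h ι) :
    leftHit f h = ∑ i ∈ r.index, f (r.left i) • r.right i := by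
  simp [leftHit, ← r.eq]

theorem apply_leftHit (f g : ConvDual k H) (h : H) : f (leftHit g h) = (g * f) h := by
  rw [leftHit_repr g (ℛ k h), (ℛ k h).convMul_apply]
  simp

end Coalgebra

section Hopf

variable {k H : Type*} [Field k] [Ring H] [HopfAlgebra k H]

/-- The functional `y ↦ f (x y)`. -/
noncomputable def preMul (f : ConvDual k H) (x : H) : ConvDual k H :=
  toConv (f.ofConv ∘ₗ LinearMap.mulLeft k x)

@[simp] theorem preMul_apply (f : ConvDual k H) (x y : H) : preMul f x y = f (x * y) := rfl

theorem rightHit_preMul (f : ConvDual k H) {x : H} {ι : Type*} (r : Coalgebra.Repr k x ι) (h : H) :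
    rightHit k H (preMul f x) h =
      ∑ i ∈ r.index, HopfAlgebra.antipode k (r.left i) * rightHit k H f (r.right i * h) := by
  obtain ⟨s⟩ : Nonempty (Coalgebra.Repr k h (H × H)) := ⟨ℛ k h⟩
  have hR : ∀ y : H, rightHit k H f (y * h) = ∑ i ∈ (ℛ k y).index, ∑ j ∈ s.index,
      f ((ℛ k y).right i * s.right j) • ((ℛ k y).left i * s.left j) := by
    intro y
    change rightHitL f (y * h) = _
    simp only [rightHitL, LinearMap.coe_mk, AddHom.coe_mk, LinearMap.comp_apply,
      Bialgebra.comul_mul]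
    rw [← (ℛ k y).eq, ← s.eq]
    simp [Finset.sum_mul_sum]
  let Φ : H ⊗[k] (H ⊗[k] H) →ₗ[k] H := ∑ j ∈ s.index,
    LinearMap.mul' k H ∘ₗ TensorProduct.map (HopfAlgebra.antipode k)
      ((TensorProduct.rid k H).toLinearMap ∘ₗ TensorProduct.map (LinearMap.mulRight k (s.left j))
        (f.ofConv ∘ₗ LinearMap.mulRight k (s.right j)))
  have hΦ : ∀ a b c, Φ (a ⊗ₜ (b ⊗ₜ c)) = ∑ j ∈ s.index,
      f (c * s.right j) • (HopfAlgebra.antipode k a * (b * s.left j)) := by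
    intro a b c
    simp [Φ, LinearMap.sum_apply]
  have h1 := congrArg Φ (Coalgebra.sum_tmul_tmul_eq r (fun i => ℛ k (r.left i))
    (fun i => ℛ k (r.right i)))
  simp only [map_sum, hΦ] at h1
  simp only [hR, Finset.mul_sum, mul_smul_comm]
  rw [← h1, rightHit_repr _ s]
  have h2 : ∀ i, ∑ l ∈ (ℛ k (r.left i)).index, ∑ j ∈ s.index, f (r.right i * s.right j) •
      (HopfAlgebra.antipode k ((ℛ k (r.left i)).left l) *
        ((ℛ k (r.left i)).right l * s.left j)) =
      ∑ j ∈ s.index, f (counit (R := k) (r.left i) • r.right i * s.right j) • s.left j := by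
    intro i
    rw [Finset.sum_comm]
    refine Finset.sum_congr rfl fun j _ => ?_
    simp only [← mul_assoc, ← Finset.smul_sum, ← Finset.sum_mul]
    rw [HopfAlgebra.sum_antipode_mul_eq_smul]
    simp [smul_smul, mul_comm]
  simp only [h2]
  rw [Finset.sum_comm]
  refine Finset.sum_congr rfl fun j _ => ?_
  rw [← Finset.sum_smul, preMul_apply, ← map_sum, ← Finset.sum_mul, Coalgebra.sum_counit_smul]

end Hopf

section Integral

variable {k H : Type*} [Field k] [Ring H] [HopfAlgebra k H]

theorem rightHit_integral {l : ConvDual k H} (hl : ∀ f : ConvDual k H, f * l = f 1 • l) (h : H) :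
    rightHit k H l h = l h • 1 :=
  convDual_ext (k := k) fun f => by
    rw [apply_rightHit, hl]
    simp [mul_comm]

theorem rightHit_preMul_integral {l : ConvDual k H} (hl : ∀ f : ConvDual k H, f * l = f 1 • l)
    (a b : H) : rightHit k H (preMul l a) b =
      ∑ i ∈ (ℛ k a).index, l ((ℛ k a).right i * b) • HopfAlgebra.antipode k ((ℛ k a).left i) := by
  rw [rightHit_preMul l (ℛ k a) b]
  simp [rightHit_integral hl]

theorem integral_apply_mul_leftHit (l f : ConvDual k H) (a b : H) :
    l (a * leftHit f b) = f (rightHit k H (preMul l a) b) := by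
  rw [apply_rightHit, ← apply_leftHit, preMul_apply]

variable [FiniteDimensional k H]

theorem integral_nondegenerate {l : ConvDual k H} (hl : ∀ f : ConvDual k H, f * l = f 1 • l)
    (hl0 : l ≠ 0) {b : H} (hb : ∀ a, l (a * b) = 0) : b = 0 := by
  have hleft : ∀ b, (∀ a, l (a * b) = 0) → ∀ (f : ConvDual k H) a, l (a * leftHit f b) = 0 := by
    intro b hb f a
    rw [integral_apply_mul_leftHit, rightHit_preMul_integral hl]
    simp [hb]
  have hcounit : ∀ b, (∀ a, l (a * b) = 0) → counit (R := k) b = 0 := by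
    intro b hb
    obtain ⟨a, ha⟩ : ∃ a, l a ≠ 0 := by
      by_contra! h
      exact hl0 (WithConv.ext (LinearMap.ext h))
    let e := Module.finBasis k H
    have hsum : comul (R := k) b = ∑ j, e j ⊗ₜ[k] leftHit (toConv (e.coord j)) b := by
      rw [← (ℛ k b).eq]
      simp only [leftHit_repr _ (ℛ k b), TensorProduct.tmul_sum, TensorProduct.tmul_smul]
      rw [Finset.sum_comm]
      refine Finset.sum_congr rfl fun i _ => ?_
      conv_lhs => rw [← e.sum_repr ((ℛ k b).left i)]
      rw [TensorProduct.sum_tmul]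
      simp [TensorProduct.smul_tmul']
    have h1 := HopfAlgebra.mul_antipode_rTensor_comul_apply (R := k) b
    rw [hsum] at h1
    have h2 := congrArg (fun x => l (a * x)) h1
    simp only [map_sum, LinearMap.rTensor_tmul, LinearMap.mul'_apply, Finset.mul_sum,
      ← mul_assoc, hleft b hb, Finset.sum_const_zero, Algebra.algebraMap_eq_smul_one,
      mul_smul_comm, mul_one, map_smul, smul_eq_mul] at h2
    exact (mul_eq_zero.1 h2.symm).resolve_right ha
  refine convDual_ext (k := k) fun f => ?_
  have := hcounit _ (hleft b hb f)
  rw [map_zero, ← mul_one f]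
  rw [← apply_leftHit]
  simpa using this

/-- Uniqueness of left integrals in the dual of a finite-dimensional Hopf algebra. -/
theorem integral_unique {l m : ConvDual k H} (hl : ∀ f : ConvDual k H, f * l = f 1 • l)
    (hl0 : l ≠ 0) (hm : ∀ f : ConvDual k H, f * m = f 1 • m) : ∃ α : k, m = α • l := by
  let Ψ : H →ₗ[k] Module.Dual k H := (LinearMap.llcomp k H H k l.ofConv) ∘ₗ
    (LinearMap.mul k H).flip
  have hΨ : ∀ b a, Ψ b a = l (a * b) := fun b a => rfl
  have hinj : Function.Injective Ψ := (injective_iff_map_eq_zero Ψ).2 fun b hb =>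
    integral_nondegenerate hl hl0 fun a => by rw [← hΨ, hb]; rfl
  obtain ⟨c, hc⟩ := (LinearMap.injective_iff_surjective_of_finrank_eq_finrank
    Subspace.dual_finrank_eq.symm).1 hinj m.ofConv
  have hc' : ∀ a, m a = l (a * c) := fun a => by rw [← hΨ, hc]
  have key : ∀ a, rightHit k H (preMul l a) c = m a • 1 := by
    intro a
    have h := congrArg (HopfAlgebra.antipode k) (rightHit_integral hm a)
    rw [rightHit_repr m (ℛ k a)] at h
    rw [rightHit_preMul_integral hl]
    simpa [hc'] using h
  have hleft : ∀ f : ConvDual k H, leftHit f c = f 1 • c := by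
    intro f
    rw [← sub_eq_zero]
    refine integral_nondegenerate hl hl0 fun a => ?_
    rw [mul_sub, map_sub, integral_apply_mul_leftHit, key, mul_smul_comm]
    simp [hc', mul_comm]
  have hcc : c = counit (R := k) c • 1 := convDual_ext (k := k) fun f => by
    have := apply_leftHit (1 : ConvDual k H) f c
    rw [mul_one, hleft] at this
    rw [← this]
    simp [mul_comm]
  refine ⟨counit (R := k) c, WithConv.ext (LinearMap.ext fun a => ?_)⟩
  rw [hc', hcc]
  simp

/-- A nonzero functional on which the dual algebra acts on the left through a grouplike element
spans a right ideal. -/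
theorem mul_eq_smul_of_left_eigen (g : GroupLike k H) {x : ConvDual k H} (hx0 : x ≠ 0)
    (hx : ∀ f : ConvDual k H, f * x = f (g : H) • x) (f : ConvDual k H) :
    ∃ α : k, x * f = α • x := by
  have hg : ((g⁻¹ : GroupLike k H) : H) * g = 1 := by
    rw [← GroupLike.val_mul, inv_mul_cancel, GroupLike.val_one]
  have hg' : (g : H) * ((g⁻¹ : GroupLike k H) : H) = 1 := by
    rw [← GroupLike.val_mul, mul_inv_cancel, GroupLike.val_one]
  have hcancel : ∀ f : ConvDual k H, preMul (preMul f g) ((g⁻¹ : GroupLike k H) : H) = f :=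
    fun f => WithConv.ext (LinearMap.ext fun h => by
      change f (_ * (_ * h)) = f h
      rw [← mul_assoc, hg', one_mul])
  have hcancel' : ∀ f : ConvDual k H, preMul (preMul f ((g⁻¹ : GroupLike k H) : H)) g = f :=
    fun f => WithConv.ext (LinearMap.ext fun h => by
      change f (_ * (_ * h)) = f h
      rw [← mul_assoc, hg, one_mul])
  have hmul : ∀ f f' : ConvDual k H, preMul (f * f') g = preMul f g * preMul f' g := by
    intro f f'
    refine WithConv.ext (LinearMap.ext fun h => ?_)
    change (f * f') (g * h) = (preMul f g * preMul f' g) h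
    rw [(ℛ k h).convMul_apply, LinearMap.convMul_apply, Bialgebra.comul_mul,
      g.2.comul_eq_tmul_self, ← (ℛ k h).eq]
    simp [Finset.mul_sum]
  have hint : ∀ y : ConvDual k H, (∀ f : ConvDual k H, f * y = f (g : H) • y) →
      ∀ f : ConvDual k H, f * preMul y g = f 1 • preMul y g := by
    intro y hy f
    conv_lhs => rw [← hcancel' f]
    rw [← hmul, hy]
    refine WithConv.ext (LinearMap.ext fun h => ?_)
    change preMul f _ (g : H) * y (g * h) = f 1 * y (g * h)
    rw [preMul_apply, hg]
  obtain ⟨α, hα⟩ := integral_unique (hint x hx)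
    (fun h => hx0 (by rw [← hcancel x, h]; rfl)) (hint (x * f) fun f' => by
      rw [← mul_assoc, hx, smul_mul_assoc])
  refine ⟨α, ?_⟩
  rw [← hcancel (x * f), hα]
  conv_rhs => rw [← hcancel x]
  rfl

end Integral

section SimpleSubcoalgebra

variable {k H : Type*} [Field k] [AddCommGroup H] [Module k H]

theorem tensor_ext_of_forall_dual [FiniteDimensional k H] {x y : H ⊗[k] H}
    (h : ∀ f g : H →ₗ[k] k, LinearMap.mul' k k (TensorProduct.map f g x) =
      LinearMap.mul' k k (TensorProduct.map f g y)) : x = y := by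
  let b := Module.finBasis k H
  have hb : ∀ (z : H ⊗[k] H) i j, (b.tensorProduct b).repr z (i, j) =
      LinearMap.mul' k k (TensorProduct.map (b.coord i) (b.coord j) z) := by
    intro z i j
    induction z with
    | zero => simp
    | add a c ha hc => simp [ha, hc]
    | tmul a c => simp [mul_comm]
  refine (b.tensorProduct b).repr.injective (Finsupp.ext fun i => ?_)
  rw [hb, hb, h]

variable [Coalgebra k H]

theorem mul_apply_eq_zero_of_subcoalg {D : Submodule k H} (hD : IsSubcoalgWrt k (comulL k H) D)
    {f g : ConvDual k H} (h : (∀ d ∈ D, f d = 0) ∨ ∀ d ∈ D, g d = 0) {d : H} (hd : d ∈ D) :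
    (f * g) d = 0 := by
  obtain ⟨t, ht⟩ := hD d hd
  rw [convDual_mul_apply_tmul]
  change LinearMap.mul' k k (TensorProduct.map f.ofConv g.ofConv (comulL k H d)) = 0
  rw [← ht]
  clear ht
  induction t with
  | zero => simp
  | add a c ha hc => simp only [map_add, ha, hc, add_zero]
  | tmul a c => rcases h with h | h <;> simp [h]

instance instFiniteDimensionalConvDual [FiniteDimensional k H] :
    FiniteDimensional k (ConvDual k H) :=
  Module.Finite.equiv (WithConv.linearEquiv k (H →ₗ[k] k)).symm

variable [FiniteDimensional k H] {S : Type*} [Ring S] [Algebra k S]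

/-- The annihilator in the coalgebra of the kernel of a homomorphism from the dual algebra. -/
def kerPerp (φ : ConvDual k H →ₐ[k] S) : Submodule k H where
  carrier := {h | ∀ f : ConvDual k H, φ f = 0 → f h = 0}
  zero_mem' f _ := map_zero _
  add_mem' ha hb f hf := by rw [map_add, ha f hf, hb f hf, add_zero]
  smul_mem' c _ ha f hf := by rw [map_smul, ha f hf, smul_zero]

theorem map_eq_zero_of_vanish_kerPerp (φ : ConvDual k H →ₐ[k] S) {f : ConvDual k H}
    (hf : ∀ h ∈ kerPerp φ, f h = 0) : φ f = 0 := by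
  let K : Submodule k (Module.Dual k H) :=
    LinearMap.ker (φ.toLinearMap ∘ₗ (WithConv.linearEquiv k (H →ₗ[k] k)).symm.toLinearMap)
  have hK : f.ofConv ∈ K.dualCoannihilator.dualAnnihilator := by
    rw [Submodule.mem_dualAnnihilator]
    intro h hh
    exact hf h fun g hg => (Submodule.mem_dualCoannihilator h).1 hh g.ofConv hg
  rw [Subspace.dualCoannihilator_dualAnnihilator_eq] at hK
  exact hK

theorem isSubcoalg_kerPerp (φ : ConvDual k H →ₐ[k] S) :
    IsSubcoalgWrt k (comulL k H) (kerPerp φ) := by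
  intro h hh
  obtain ⟨P, hP⟩ := (kerPerp φ).subtype.exists_leftInverse_of_injective (Submodule.ker_subtype _)
  have hP' : ∀ c : kerPerp φ, P c = c := fun c => LinearMap.congr_fun hP c
  let Q : H →ₗ[k] H := (kerPerp φ).subtype ∘ₗ P
  have hQ : ∀ u : H →ₗ[k] k, φ (toConv (u ∘ₗ Q) - toConv u) = 0 := fun u =>
    map_eq_zero_of_vanish_kerPerp φ fun c hc => by
      have : Q c = c := congrArg Subtype.val (hP' ⟨c, hc⟩)
      simp [this]
  refine ⟨TensorProduct.map P P (comul h), ?_⟩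
  rw [← LinearMap.comp_apply, ← TensorProduct.map_comp]
  refine tensor_ext_of_forall_dual fun u v => ?_
  rw [← LinearMap.comp_apply (TensorProduct.map u v), ← TensorProduct.map_comp]
  change (toConv (u ∘ₗ Q) * toConv (v ∘ₗ Q)) h = (toConv u * toConv v) h
  have h0 : φ (toConv (u ∘ₗ Q) * toConv (v ∘ₗ Q) - toConv u * toConv v) = 0 := by
    have hu := hQ u
    have hv := hQ v
    rw [map_sub, sub_eq_zero] at hu hv
    rw [map_sub, map_mul, map_mul, hu, hv, sub_self]
  have := hh _ h0
  rwa [WithConv.ofConv_sub, LinearMap.sub_apply, sub_eq_zero] at this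

theorem isSimpleSubcoalg_kerPerp [IsSimpleRing S] {φ : ConvDual k H →ₐ[k] S}
    (hφ : Function.Surjective φ) : IsSimpleSubcoalgWrt k (comulL k H) (kerPerp φ) := by
  refine ⟨isSubcoalg_kerPerp φ, fun hbot => ?_, fun D hD hlt => ?_⟩
  · have : φ 1 = 0 := map_eq_zero_of_vanish_kerPerp φ fun h hh => by
      rw [hbot, Submodule.mem_bot] at hh
      rw [hh, map_zero]
    rw [map_one] at this
    exact one_ne_zero this
  · obtain ⟨hle, c, hc, hcD⟩ := SetLike.lt_iff_le_and_exists.1 hlt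
    obtain ⟨f, hfc, hfD⟩ := Submodule.exists_dual_map_eq_bot_of_notMem hcD inferInstance
    let I : TwoSidedIdeal S := TwoSidedIdeal.mk' {s | ∃ f : ConvDual k H, (∀ d ∈ D, f d = 0) ∧
        φ f = s}
      ⟨0, fun _ _ => rfl, map_zero _⟩
      (by
        rintro _ _ ⟨f, hf, rfl⟩ ⟨g, hg, rfl⟩
        exact ⟨f + g, fun d hd => by simp [hf d hd, hg d hd], map_add _ _ _⟩)
      (by
        rintro _ ⟨f, hf, rfl⟩
        exact ⟨-f, fun d hd => by simp [hf d hd], map_neg _ _⟩)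
      (by
        rintro x _ ⟨f, hf, rfl⟩
        obtain ⟨g, rfl⟩ := hφ x
        exact ⟨g * f, fun d hd => mul_apply_eq_zero_of_subcoalg hD (Or.inr hf) hd,
          map_mul _ _ _⟩)
      (by
        rintro _ x ⟨f, hf, rfl⟩
        obtain ⟨g, rfl⟩ := hφ x
        exact ⟨f * g, fun d hd => mul_apply_eq_zero_of_subcoalg hD (Or.inl hf) hd,
          map_mul _ _ _⟩)
    have hI : ∀ s, s ∈ I ↔ ∃ f : ConvDual k H, (∀ d ∈ D, f d = 0) ∧ φ f = s := fun s => by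
      simp [I, TwoSidedIdeal.mem_mk']
    have hfD' : ∀ d ∈ D, f d = 0 := fun d hd => by
      have : f d ∈ D.map f := ⟨d, hd, rfl⟩
      rwa [hfD, Submodule.mem_bot] at this
    have hne : φ (toConv f) ≠ 0 := fun h0 => hfc (hc _ h0)
    obtain ⟨g, hg, hg1⟩ := (hI 1).1
      (IsSimpleRing.one_mem_of_ne_zero_mem I hne ((hI _).2 ⟨toConv f, hfD', rfl⟩))
    have hone : ∀ d ∈ D, (1 : ConvDual k H) d = 0 := fun d hd => by
      have := hle hd (g - 1) (by rw [map_sub, hg1, map_one, sub_self])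
      rw [WithConv.ofConv_sub, LinearMap.sub_apply, hg d hd, zero_sub, neg_eq_zero] at this
      exact this
    refine (Submodule.eq_bot_iff _).2 fun d hd => convDual_ext (k := k) fun u => ?_
    rw [map_zero, ← mul_one u]
    exact mul_apply_eq_zero_of_subcoalg hD (Or.inr hone) hd

/-- Functionals vanishing on the coradical lie in the Jacobson radical of the dual algebra. -/
theorem mem_jacobson_of_vanish_coradical [IsAlgClosed k] {f : ConvDual k H}
    (hf : ∀ h ∈ coradical k H, f h = 0) : f ∈ Ring.jacobson (ConvDual k H) := by
  have : IsArtinianRing (ConvDual k H) := IsArtinianRing.of_finite k _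
  have : IsSemisimpleRing (ConvDual k H ⧸ Ring.jacobson (ConvDual k H)) :=
    IsSemiprimaryRing.isSemisimpleRing
  obtain ⟨m, d, hd, ⟨e⟩⟩ := IsSemisimpleRing.exists_algEquiv_pi_matrix_of_isAlgClosed k
    (ConvDual k H ⧸ Ring.jacobson (ConvDual k H))
  have key : e (Ideal.Quotient.mk _ f) = 0 := by
    funext i
    have := hd i
    let φ : ConvDual k H →ₐ[k] Matrix (Fin (d i)) (Fin (d i)) k :=
      ((Pi.evalAlgHom k _ i).comp e.toAlgHom).comp (Ideal.Quotient.mkₐ k _)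
    have hφ : Function.Surjective φ := by
      intro M
      obtain ⟨x, hx⟩ := Ideal.Quotient.mk_surjective (e.symm (Pi.single i M))
      refine ⟨x, ?_⟩
      change e (Ideal.Quotient.mk _ x) i = M
      rw [hx]
      simp
    exact map_eq_zero_of_vanish_kerPerp φ fun h hh =>
      hf h (le_sSup (a := kerPerp φ) (isSimpleSubcoalg_kerPerp hφ) hh)
  rwa [map_eq_zero_iff _ e.injective, Ideal.Quotient.eq_zero_iff_mem] at key

end SimpleSubcoalgebra

section CoradicalRep

variable {k H : Type*} [Field k] [AddCommGroup H] [Module k H] [Coalgebra k H]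
  {I N : Type*} [Fintype N] [DecidableEq N]

/-- The representation of the dual algebra given by the grouplike elements and a family of
multiplicative matrices. -/
noncomputable def coradicalRep (T : I → N → N → H) (hT : ∀ i, IsMultiplicative (k := k) (T i)) :
    ConvDual k H →ₐ[k] (GroupLike k H → k) × (I → Matrix N N k) :=
  (AlgHom.pi evalGroupLike).prod (AlgHom.pi fun i => matrixRep (T i) (hT i))

@[simp] theorem coradicalRep_fst {T : I → N → N → H}
    (hT : ∀ i, IsMultiplicative (k := k) (T i)) (f : ConvDual k H) (g : GroupLike k H) :
    (coradicalRep T hT f).1 g = f (g : H) := rfl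

@[simp] theorem coradicalRep_snd {T : I → N → N → H}
    (hT : ∀ i, IsMultiplicative (k := k) (T i)) (f : ConvDual k H) (i : I) (a b : N) :
    (coradicalRep T hT f).2 i a b = f (T i a b) := rfl

theorem coradicalRep_surjective {T : I → N → N → H}
    (hT : ∀ i, IsMultiplicative (k := k) (T i))
    (hli : LinearIndependent k (Sum.elim (GroupLike.val (R := k) (A := H))
      fun x : Σ _ : I, N × N => T x.1 x.2.1 x.2.2)) :
    Function.Surjective (coradicalRep T hT) := by
  intro y
  obtain ⟨L, hL⟩ := (Finsupp.linearCombination k (Sum.elim (GroupLike.val (R := k) (A := H))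
      fun x : Σ _ : I, N × N => T x.1 x.2.1 x.2.2)).exists_leftInverse_of_injective
    (LinearMap.ker_eq_bot.2 hli)
  have hL' : ∀ x, L (Sum.elim (GroupLike.val (R := k) (A := H))
      (fun x : Σ _ : I, N × N => T x.1 x.2.1 x.2.2) x) = Finsupp.single x 1 := fun x => by
    have := LinearMap.congr_fun hL (Finsupp.single x 1)
    simpa using this
  refine ⟨toConv (Finsupp.linearCombination k (Sum.elim y.1
    fun x : Σ _ : I, N × N => y.2 x.1 x.2.1 x.2.2) ∘ₗ L), Prod.ext ?_ ?_⟩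
  · funext g
    have := hL' (Sum.inl g)
    simp only [Sum.elim_inl] at this
    simp [this]
  · funext i
    ext a b
    have := hL' (Sum.inr ⟨i, a, b⟩)
    simp only [Sum.elim_inr] at this
    simp [this]

end CoradicalRep

variable (k H I N : Type*) [Field k] [AddCommGroup H] [Module k H] [Coalgebra k H]
  [DecidableEq I] [Fintype N] [DecidableEq N] [DecidableEq (GroupLike k H)]

/-- A coalgebra whose coradical is the sum of the span of the grouplike elements and of matrix
coalgebras of the same size, together with primitive idempotents of the dual algebra. -/
structure MatrixCoradical (n₀ : N) where
  T : I → N → N → H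
  mult : ∀ i, IsMultiplicative (k := k) (T i)
  surj : Function.Surjective (coradicalRep T mult)
  ker_le : ∀ f, coradicalRep T mult f = 0 → f ∈ Ring.jacobson (ConvDual k H)
  ε : GroupLike k H → ConvDual k H
  rep_ε : ∀ g, coradicalRep T mult (ε g) = (Pi.single g 1, 0)
  ε_idem : ∀ g, IsIdempotentElem (ε g)
  η : I → ConvDual k H
  rep_η : ∀ i, coradicalRep T mult (η i) = (0, Pi.single i (Matrix.single n₀ n₀ 1))
  η_idem : ∀ i, IsIdempotentElem (η i)

variable {k H I N}

theorem nonempty_matrixCoradical [FiniteDimensional k H] [Fintype I] [Fintype (GroupLike k H)]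
    (n₀ : N) {T : I → N → N → H} (mult : ∀ i, IsMultiplicative (k := k) (T i))
    (surj : Function.Surjective (coradicalRep T mult))
    (ker_le : ∀ f, coradicalRep T mult f = 0 → f ∈ Ring.jacobson (ConvDual k H)) :
    Nonempty (MatrixCoradical k H I N n₀) := by
  have hε : ∀ g : GroupLike k H, ∃ e : ConvDual k H, IsIdempotentElem e ∧
      coradicalRep T mult e = (Pi.single g 1, 0) := fun g =>
    exists_idempotent_lift surj ker_le (by
      rw [IsIdempotentElem, Prod.mk_mul_mk, ← Pi.single_mul, mul_one, mul_zero])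
  have hη : ∀ i : I, ∃ e : ConvDual k H, IsIdempotentElem e ∧
      coradicalRep T mult e = (0, Pi.single i (Matrix.single n₀ n₀ 1)) := fun g =>
    exists_idempotent_lift surj ker_le (by
      rw [IsIdempotentElem, Prod.mk_mul_mk, ← Pi.single_mul, mul_zero,
        Matrix.single_mul_single_same, mul_one])
  choose ε hε hε' using hε
  choose η hη hη' using hη
  exact ⟨⟨T, mult, surj, ker_le, ε, hε', hε, η, hη', hη⟩⟩

namespace MatrixCoradical

variable {n₀ : N} (D : MatrixCoradical k H I N n₀)

/-- The character of the `i`-th matrix coalgebra. -/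
noncomputable def v (i : I) : H := ∑ a, D.T i a a

theorem trace_rep (f : ConvDual k H) (i : I) :
    ((coradicalRep D.T D.mult f).2 i).trace = f (D.v i) := by
  simp [Matrix.trace, v]

theorem ε_groupLike (g h : GroupLike k H) : D.ε g (h : H) = if h = g then 1 else 0 := by
  rw [← coradicalRep_fst D.mult, D.rep_ε]
  simp [Pi.single_apply]

theorem ε_T (g : GroupLike k H) (i : I) (a b : N) : D.ε g (D.T i a b) = 0 := by
  rw [← coradicalRep_snd D.mult, D.rep_ε]
  rfl

theorem ε_v (g : GroupLike k H) (i : I) : D.ε g (D.v i) = 0 := by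
  simp [v, D.ε_T]

theorem η_groupLike (i : I) (g : GroupLike k H) : D.η i (g : H) = 0 := by
  rw [← coradicalRep_fst D.mult, D.rep_η]
  rfl

theorem η_T (i j : I) (a b : N) :
    D.η i (D.T j a b) = if j = i ∧ a = n₀ ∧ b = n₀ then 1 else 0 := by
  rw [← coradicalRep_snd D.mult, D.rep_η]
  by_cases h : j = i
  · subst h
    simp [Matrix.single_apply, eq_comm]
  · simp [h]

theorem η_v (i j : I) : D.η i (D.v j) = if j = i then 1 else 0 := by
  by_cases h : j = i <;> simp [v, D.η_T, h]

theorem counit_v (i : I) : counit (R := k) (D.v i) = Fintype.card N := by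
  simp [v, (D.mult i).counit_eq]

variable [FiniteDimensional k H] [Fintype I] [Fintype (GroupLike k H)]

theorem trace_eq {M : Type*} [AddCommGroup M] [Module k M] [FiniteDimensional k M]
    (ρ : ConvDual k H →ₐ[k] Module.End k M) (f : ConvDual k H) :
    LinearMap.trace k M (ρ f) =
      f (∑ g, (Module.finrank k (LinearMap.range (ρ (D.ε g))) : k) • (g : H) +
        ∑ i, (Module.finrank k (LinearMap.range (ρ (D.η i))) : k) • D.v i) := by
  rw [trace_decomposition n₀ D.surj D.ker_le D.rep_ε D.ε_idem D.rep_η D.η_idem ρ f]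
  simp [D.trace_rep]

variable [CharZero k]

theorem finrank_eq {M : Type*} [AddCommGroup M] [Module k M] [FiniteDimensional k M]
    (ρ : ConvDual k H →ₐ[k] Module.End k M) :
    Module.finrank k M = ∑ g, Module.finrank k (LinearMap.range (ρ (D.ε g))) +
      Fintype.card N * ∑ i, Module.finrank k (LinearMap.range (ρ (D.η i))) := by
  have h := D.trace_eq ρ 1
  rw [map_one, LinearMap.trace_one] at h
  have h1 : ∀ x : H, (1 : ConvDual k H) x = counit (R := k) x := fun x => rfl
  rw [h1] at h
  simp only [map_add, map_sum, map_smul, D.counit_v, smul_eq_mul,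
    (GroupLike.isGroupLikeElem_val _).counit_eq_one, mul_one] at h
  rw [← Finset.sum_mul, mul_comm] at h
  exact_mod_cast h

/-- The trace of a multiplicative matrix is a combination with natural coefficients of grouplike
elements and irreducible characters. -/
theorem exists_trace_multiplicative {ι : Type*} [Fintype ι] [DecidableEq ι] {X : ι → ι → H}
    (hX : IsMultiplicative (k := k) X) : ∃ (a : GroupLike k H → ℕ) (b : I → ℕ),
      ∑ x, X x x = ∑ g, (a g : k) • (g : H) + ∑ i, (b i : k) • D.v i ∧
      Fintype.card ι = ∑ g, a g + Fintype.card N * ∑ i, b i := by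
  let ρ : ConvDual k H →ₐ[k] Module.End k (ι → k) :=
    (Matrix.toLinAlgEquiv' : Matrix ι ι k ≃ₐ[k] _).toAlgHom.comp (matrixRep X hX)
  refine ⟨fun g => Module.finrank k (LinearMap.range (ρ (D.ε g))),
    fun i => Module.finrank k (LinearMap.range (ρ (D.η i))), convDual_ext (k := k) fun f => ?_, ?_⟩
  · rw [← D.trace_eq ρ f]
    refine Eq.trans ?_ (Matrix.trace_toLin'_eq (matrixRep X hX f)).symm
    simp [Matrix.trace]
  · rw [← D.finrank_eq ρ, Module.finrank_fintype_fun_eq_card]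

end MatrixCoradical

theorem mul_eq_zero_of_mem_jacobson_of_isAtom {A : Type*} [Ring A] [IsArtinianRing A]
    {L : Ideal A} (hL : IsAtom L) {x y : A} (hx : x ∈ Ring.jacobson A) (hy : y ∈ L) :
    x * y = 0 := by
  by_contra hxy
  have hle : Ideal.span {x * y} ≤ L := (Ideal.span_singleton_le_iff_mem _).2 (L.mul_mem_left x hy)
  have heq := (hL.le_iff_eq (by simpa using hxy)).1 hle
  rw [← heq, Ideal.mem_span_singleton'] at hy
  obtain ⟨a, ha⟩ := hy
  obtain ⟨m, hm⟩ := isNilpotent_of_mem_jacobson ((Ring.jacobson A).mul_mem_left a hx)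
  have hpow : ∀ m, (a * x) ^ m * y = y := fun m => by
    induction m with
    | zero => simp
    | succ m ih => rw [pow_succ, mul_assoc, mul_assoc a, ha, ih]
  have := hpow m
  rw [hm, zero_mul] at this
  rw [← this, mul_zero] at hxy
  exact hxy rfl

namespace MatrixCoradical

section Coalgebra

variable {k H I N : Type*} [Field k] [AddCommGroup H] [Module k H] [Coalgebra k H]
  [DecidableEq I] [Fintype N] [DecidableEq N] [DecidableEq (GroupLike k H)] {n₀ : N}
  (D : MatrixCoradical k H I N n₀)

theorem mul_η_apply_T (f : ConvDual k H) (i : I) (a : N) :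
    (f * D.η i) (D.T i a n₀) = f (D.T i a n₀) := by
  have := congrFun (congrFun (map_mul (matrixRep (D.T i) (D.mult i)) f (D.η i)) a) n₀
  rw [Matrix.mul_apply] at this
  simpa [D.η_T] using this

theorem rep_mul_η_eq_zero {f : ConvDual k H} {i : I} (hf : ∀ a, f (D.T i a n₀) = 0) :
    coradicalRep D.T D.mult (f * D.η i) = 0 := by
  rw [map_mul, D.rep_η]
  refine Prod.ext ?_ (funext fun j => ?_)
  · simp
  · by_cases h : j = i
    · subst h
      ext a b
      simp [Matrix.mul_apply, Matrix.single_apply, ite_and, hf]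
    · simp [h]

/-- The dimension of the projective cover of the `i`-th simple comodule. -/
noncomputable def c (i : I) : ℕ := Module.finrank k (LinearMap.range (rightHit k H (D.η i)))

theorem c_eq_finrank (i : I) :
    D.c i = Module.finrank k (LinearMap.range (LinearMap.mulRight k (D.η i))) := by
  let w := WithConv.linearEquiv k (H →ₗ[k] k)
  have h : (rightHit k H (D.η i)).dualMap =
      w.toLinearMap ∘ₗ LinearMap.mulRight k (D.η i) ∘ₗ w.symm.toLinearMap :=
    LinearMap.ext fun f => LinearMap.ext fun x => apply_rightHit (toConv f) (D.η i) x
  rw [c, ← LinearMap.finrank_range_dualMap_eq_finrank_range, h, LinearMap.range_comp,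
    LinearEquiv.finrank_map_eq, LinearMap.range_comp, LinearEquiv.range, Submodule.map_top]

variable [FiniteDimensional k H]

/-- The left ideal of functionals `f = f * η i` that vanish on the coradical. -/
def radIdeal (i : I) : Ideal (ConvDual k H) where
  carrier := {f | f * D.η i = f ∧ coradicalRep D.T D.mult f = 0}
  zero_mem' := ⟨zero_mul _, map_zero _⟩
  add_mem' ha hb := ⟨by rw [add_mul, ha.1, hb.1], by rw [map_add, ha.2, hb.2, add_zero]⟩
  smul_mem' x _ ha := ⟨by rw [smul_eq_mul, mul_assoc, ha.1],
    by rw [smul_eq_mul, map_mul, ha.2, mul_zero]⟩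

theorem c_eq_add (i : I) : D.c i = Fintype.card N + Module.finrank k (D.radIdeal i) := by
  let W := LinearMap.range (LinearMap.mulRight k (D.η i))
  have hW : ∀ f ∈ W, f * D.η i = f := by
    rintro _ ⟨f, rfl⟩
    rw [LinearMap.mulRight_apply, mul_assoc, (D.η_idem i).eq]
  let κ : W →ₗ[k] N → k :=
    { toFun := fun f a => f.1 (D.T i a n₀)
      map_add' := fun _ _ => rfl
      map_smul' := fun _ _ => rfl }
  have hκ : Function.Surjective κ := by
    intro y
    obtain ⟨f, hf⟩ := D.surj (0, fun _ => Matrix.of fun a _ => y a)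
    refine ⟨⟨f * D.η i, f, rfl⟩, funext fun a => ?_⟩
    change (f * D.η i) (D.T i a n₀) = y a
    rw [D.mul_η_apply_T, ← coradicalRep_snd D.mult, hf]
    rfl
  have hker : Module.finrank k (LinearMap.ker κ) = Module.finrank k (D.radIdeal i) := by
    refine LinearEquiv.finrank_eq
      { toFun := fun f => ⟨f.1.1, hW _ f.1.2, ?_⟩
        invFun := fun f => ⟨⟨f.1, f.1, f.2.1⟩, ?_⟩
        map_add' := fun _ _ => rfl
        map_smul' := fun _ _ => rfl
        left_inv := fun _ => rfl
        right_inv := fun _ => rfl }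
    · rw [← hW _ f.1.2]
      exact D.rep_mul_η_eq_zero fun a => congrFun f.2 a
    · funext a
      change f.1 (D.T i a n₀) = 0
      rw [← coradicalRep_snd D.mult, f.2.2]
      rfl
  have hrank := LinearMap.finrank_range_add_finrank_ker (V := W) κ
  rw [LinearMap.range_eq_top.2 hκ, finrank_top, Module.finrank_fintype_fun_eq_card, hker] at hrank
  exact (D.c_eq_finrank i).trans hrank.symm

variable [Fintype I] [Fintype (GroupLike k H)] [CharZero k]

/-- A nonzero left ideal of dimension less than the size of the matrices whose elements are killed
by the radical contains an eigenvector for a grouplike character. -/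
theorem exists_eigenvector_of_finrank_lt {L : Ideal (ConvDual k H)} (hL : L ≠ ⊥)
    (hker : ∀ f, coradicalRep D.T D.mult f = 0 → ∀ y ∈ L, f * y = 0)
    (hlt : Module.finrank k L < Fintype.card N) :
    ∃ (g : GroupLike k H) (x : ConvDual k H), x ∈ L ∧ x ≠ 0 ∧ ∀ f, f * x = f (g : H) • x := by
  have : FiniteDimensional k L :=
    inferInstanceAs (FiniteDimensional k (L.restrictScalars k))
  have hdim := D.finrank_eq (M := L) (Algebra.lsmul k k L)
  have hpos : 0 < Module.finrank k L := by
    have : Nontrivial L := (Submodule.nontrivial_iff_ne_bot).2 hL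
    exact Module.finrank_pos (R := k) (M := L)
  have hzero : ∑ i, Module.finrank k (LinearMap.range (Algebra.lsmul k k L (D.η i))) = 0 := by
    by_contra h
    have := Nat.le_mul_of_pos_right (Fintype.card N) (Nat.pos_of_ne_zero h)
    omega
  obtain ⟨g, -, hg⟩ : ∃ g ∈ Finset.univ,
      Module.finrank k (LinearMap.range (Algebra.lsmul k k L (D.ε g))) ≠ 0 := by
    refine Finset.exists_ne_zero_of_sum_ne_zero fun h => ?_
    rw [h, hzero] at hdim
    omega
  have hg' : ∃ y : L, D.ε g • y ≠ 0 := by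
    by_contra! h
    refine hg ?_
    rw [show Algebra.lsmul k k L (D.ε g) = 0 from LinearMap.ext h, LinearMap.range_zero,
      finrank_bot]
  obtain ⟨y, hy⟩ := hg'
  refine ⟨g, D.ε g * y, L.mul_mem_left _ y.2, fun h => hy (Subtype.ext h), fun f => ?_⟩
  rw [← mul_assoc, ← smul_mul_assoc, ← sub_eq_zero, ← sub_mul]
  refine hker _ ?_ _ y.2
  rw [map_sub, map_mul, map_smul, D.rep_ε]
  refine Prod.ext (funext fun h => ?_) ?_
  · by_cases hh : h = g
    · subst hh
      simp
    · simp [hh]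
  · simp

end Coalgebra

variable {k H I N : Type*} [Field k] [Ring H] [HopfAlgebra k H]
  [DecidableEq I] [Fintype N] [DecidableEq N] [DecidableEq (GroupLike k H)] {n₀ : N}
  (D : MatrixCoradical k H I N n₀) [FiniteDimensional k H]

theorem eq_zero_of_left_eigen {b : N} (hb : b ≠ n₀) {i : I} {x : ConvDual k H}
    (g : GroupLike k H) (hx : ∀ f, f * x = f (g : H) • x) (hxe : x * D.η i = x) : x = 0 := by
  by_contra hx0
  have : IsArtinianRing (ConvDual k H) := IsArtinianRing.of_finite k _
  have hpow : ∀ (u : ConvDual k H) (α : k), x * u = α • x → ∀ m, x * u ^ m = α ^ m • x := by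
    intro u α hu m
    induction m with
    | zero => simp
    | succ m ih => rw [pow_succ, ← mul_assoc, ih, smul_mul_assoc, hu, smul_smul, pow_succ]
  have hnil : ∀ (u : ConvDual k H) (α : k), coradicalRep D.T D.mult u = 0 → x * u = α • x →
      α = 0 := by
    intro u α hu hxu
    obtain ⟨m, hm⟩ := isNilpotent_of_mem_jacobson (D.ker_le u hu)
    have := hpow u α hxu m
    rw [hm, mul_zero] at this
    exact eq_zero_of_pow_eq_zero ((smul_eq_zero.1 this.symm).resolve_right hx0)
  obtain ⟨u, hu⟩ := D.surj (0, Pi.single i (Matrix.single n₀ b 1))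
  obtain ⟨w, hw⟩ := D.surj (0, Pi.single i (Matrix.single b n₀ 1))
  obtain ⟨α, hα⟩ := mul_eq_smul_of_left_eigen g hx0 hx u
  have hα0 : α ^ 2 = 0 := by
    refine hnil (u ^ 2) _ ?_ (hpow u α hα 2)
    rw [map_pow, hu, sq, Prod.mk_mul_mk, ← Pi.single_mul, mul_zero,
      Matrix.single_mul_single_of_ne (h := hb), Pi.single_zero]
    rfl
  rw [pow_eq_zero_iff two_ne_zero] at hα0
  rw [hα0, zero_smul] at hα
  refine one_ne_zero (hnil (D.η i - u * w) 1 ?_ ?_)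
  · rw [map_sub, map_mul, hu, hw, D.rep_η, Prod.mk_mul_mk, ← Pi.single_mul, mul_zero,
      Matrix.single_mul_single_same, mul_one, sub_self]
  · rw [mul_sub, ← mul_assoc, hα, hxe, zero_mul, sub_zero, one_smul]

variable [Fintype I] [Fintype (GroupLike k H)] [CharZero k]

theorem c_eq_card_of_lt {b : N} (hb : b ≠ n₀) {i : I} (hi : D.c i < 2 * Fintype.card N) :
    D.c i = Fintype.card N := by
  have : IsArtinianRing (ConvDual k H) := IsArtinianRing.of_finite k _
  have hc := D.c_eq_add i
  by_contra hne
  have hbot : D.radIdeal i ≠ ⊥ := fun h => by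
    rw [h, Module.finrank_zero_of_subsingleton] at hc
    omega
  obtain ⟨L, hL, hle⟩ := (IsAtomic.eq_bot_or_exists_atom_le (D.radIdeal i)).resolve_left hbot
  have hfin : Module.finrank k L ≤ Module.finrank k (D.radIdeal i) := by
    have : FiniteDimensional k ((D.radIdeal i).restrictScalars k) := inferInstance
    exact Submodule.finrank_mono (s := L.restrictScalars k)
      (t := (D.radIdeal i).restrictScalars k) hle
  obtain ⟨g, x, hxL, hx0, hx⟩ := D.exists_eigenvector_of_finrank_lt hL.1
    (fun f hf y hy => mul_eq_zero_of_mem_jacobson_of_isAtom hL (D.ker_le f hf) hy) (by omega)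
  exact hx0 (D.eq_zero_of_left_eigen hb g hx (hle hxL).1)

end MatrixCoradical

section Multiplicative

variable {k H : Type*} [Field k] [Ring H] [HopfAlgebra k H]
  {ι κ : Type*} [Fintype ι] [DecidableEq ι] [Fintype κ] [DecidableEq κ]

theorem IsMultiplicative.mul {X : ι → ι → H} {Y : κ → κ → H}
    (hX : IsMultiplicative (k := k) X) (hY : IsMultiplicative (k := k) Y) :
    IsMultiplicative (k := k) fun x y : ι × κ => X x.1 y.1 * Y x.2 y.2 where
  comul_eq x y := by
    rw [Bialgebra.comul_mul, hX.comul_eq, hY.comul_eq, Finset.sum_mul_sum,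
      Fintype.sum_prod_type]
    simp
  counit_eq x y := by
    rw [Bialgebra.counit_mul, hX.counit_eq, hY.counit_eq]
    simp only [Prod.ext_iff, ite_and, mul_ite, mul_one, mul_zero]
    split_ifs <;> rfl

omit [DecidableEq ι] [DecidableEq κ] in
theorem IsMultiplicative.trace_mul {X : ι → ι → H} {Y : κ → κ → H} :
    ∑ x : ι × κ, X x.1 x.1 * Y x.2 x.2 = (∑ x, X x x) * ∑ y, Y y y := by
  rw [Finset.sum_mul_sum, Fintype.sum_prod_type]

theorem isMultiplicative_groupLike (g : GroupLike k H) :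
    IsMultiplicative (k := k) fun _ _ : Unit => (g : H) where
  comul_eq _ _ := by simp [g.2.comul_eq_tmul_self]
  counit_eq _ _ := by simp [g.2.counit_eq_one]

/-- Averaging the trace of `h ↦ h₁ f(y h₂)` over the diagonal of a multiplicative matrix. -/
theorem sum_trace_rightHit_preMul {X : ι → ι → H}
    (hX : IsMultiplicative (k := k) X) (f : ConvDual k H) :
    ∑ x, LinearMap.trace k H (rightHit k H (preMul f (X x x))) =
      Fintype.card ι * LinearMap.trace k H (rightHit k H f) := by
  have h1 : ∀ x, rightHit k H (preMul f (X x x)) = ∑ l,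
      LinearMap.mulLeft k (HopfAlgebra.antipode k (X x l)) *
        (rightHit k H f * LinearMap.mulLeft k (X l x)) := by
    intro x
    ext h
    let r : Coalgebra.Repr k (X x x) ι :=
      { index := Finset.univ, left := fun l => X x l, right := fun l => X l x,
        eq := (hX.comul_eq x x).symm }
    rw [rightHit_preMul f r h]
    simp [r, LinearMap.sum_apply]
  have h2 : ∀ l, ∑ x, X l x * HopfAlgebra.antipode k (X x l) = 1 := by
    intro l
    let r : Coalgebra.Repr k (X l l) ι :=
      { index := Finset.univ, left := fun x => X l x, right := fun x => X x l,
        eq := (hX.comul_eq l l).symm }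
    have := HopfAlgebra.sum_mul_antipode_eq_smul r
    simpa [r, hX.counit_eq] using this
  have h3 : ∀ l x, LinearMap.trace k H
      (LinearMap.mulLeft k (HopfAlgebra.antipode k (X x l)) *
        (rightHit k H f * LinearMap.mulLeft k (X l x))) =
      LinearMap.trace k H (rightHit k H f *
        LinearMap.mulLeft k (X l x * HopfAlgebra.antipode k (X x l))) := by
    intro l x
    rw [LinearMap.trace_mul_comm, mul_assoc, LinearMap.mulLeft_mul]
    rfl
  simp only [h1, map_sum, h3]
  rw [Finset.sum_comm]
  have h4 : ∀ l, ∑ x, LinearMap.trace k H (rightHit k H f *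
      LinearMap.mulLeft k (X l x * HopfAlgebra.antipode k (X x l))) =
      LinearMap.trace k H (rightHit k H f) := by
    intro l
    rw [← map_sum, ← Finset.mul_sum]
    congr 1
    have : ∑ x, LinearMap.mulLeft k (X l x * HopfAlgebra.antipode k (X x l)) = 1 := by
      ext h
      rw [LinearMap.sum_apply]
      simp only [LinearMap.mulLeft_apply]
      rw [← Finset.sum_mul, h2, one_mul]
      rfl
    rw [this, mul_one]
  rw [Finset.sum_congr rfl fun l _ => h4 l, Finset.sum_const, Finset.card_univ, nsmul_eq_mul]

end Multiplicative

namespace MatrixCoradical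

variable {k H I N : Type*} [Field k] [Ring H] [HopfAlgebra k H]
  [DecidableEq I] [Fintype N] [DecidableEq N] [DecidableEq (GroupLike k H)] {n₀ : N}
  (D : MatrixCoradical k H I N n₀)

theorem v_injective : Function.Injective D.v := fun i j h => by
  by_contra hij
  have := D.η_v i i
  rw [h, D.η_v, if_neg (Ne.symm hij), if_pos rfl] at this
  exact zero_ne_one this

/-- The dimension of the projective cover of the one-dimensional comodule of a grouplike. -/
noncomputable def d (g : GroupLike k H) : ℕ :=
  Module.finrank k (LinearMap.range (rightHit k H (D.ε g)))

variable [FiniteDimensional k H]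

theorem d_pos (g : GroupLike k H) : 0 < D.d g := by
  have h : rightHit k H (D.ε g) g ≠ 0 := by
    let r : Coalgebra.Repr k (g : H) Unit :=
      { index := Finset.univ
        left := fun _ => (g : H)
        right := fun _ => (g : H)
        eq := by simp [g.2.comul_eq_tmul_self] }
    rw [rightHit_repr (D.ε g) r]
    simpa [r, D.ε_groupLike] using g.2.ne_zero
  have : Nontrivial (LinearMap.range (rightHit k H (D.ε g))) :=
    ⟨⟨_, LinearMap.mem_range_self _ _⟩, 0, fun h0 => h (congrArg Subtype.val h0)⟩
  exact Module.finrank_pos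

variable [Fintype I] [Fintype (GroupLike k H)]

/-- The character of the regular comodule. -/
noncomputable def χ : H := ∑ g, (D.d g : k) • (g : H) + ∑ i, (D.c i : k) • D.v i

theorem apply_χ (f : ConvDual k H) : f D.χ = LinearMap.trace k H (rightHit k H f) :=
  (D.trace_eq (rightHit k H) f).symm

omit [FiniteDimensional k H] in
theorem ε_χ (g : GroupLike k H) : D.ε g D.χ = D.d g := by
  simp [χ, D.ε_groupLike, D.ε_v]

omit [FiniteDimensional k H] in
theorem η_χ (i : I) : D.η i D.χ = D.c i := by
  simp [χ, D.η_groupLike, D.η_v]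

theorem trace_mul_χ {ι : Type*} [Fintype ι] [DecidableEq ι] {X : ι → ι → H}
    (hX : IsMultiplicative (k := k) X) : (∑ x, X x x) * D.χ = (Fintype.card ι : k) • D.χ :=
  convDual_ext (k := k) fun f => by
    rw [map_smul, D.apply_χ, smul_eq_mul, ← sum_trace_rightHit_preMul hX f, Finset.sum_mul,
      map_sum]
    exact Finset.sum_congr rfl fun x _ => D.apply_χ (preMul f (X x x))

theorem groupLike_mul_χ (g : GroupLike k H) : (g : H) * D.χ = D.χ := by
  simpa using D.trace_mul_χ (isMultiplicative_groupLike g)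

theorem v_mul_χ (i : I) : D.v i * D.χ = (Fintype.card N : k) • D.χ :=
  D.trace_mul_χ (D.mult i)

variable [CharZero k]

theorem finrank_eq_sum : Module.finrank k H = ∑ g, D.d g + Fintype.card N * ∑ i, D.c i :=
  D.finrank_eq (rightHit k H)

/-- The trace of a multiplicative matrix of the size of the simple ones is an irreducible character
or a combination of grouplike elements. -/
theorem exists_eq_v_or_mem_span {ι : Type*} [Fintype ι] [DecidableEq ι] {X : ι → ι → H}
    (hX : IsMultiplicative (k := k) X) (hι : Fintype.card ι = Fintype.card N) :
    (∃ i, ∑ x, X x x = D.v i) ∨ ∃ a : GroupLike k H → k, ∑ x, X x x = ∑ g, a g • (g : H) := by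
  obtain ⟨a, b, hab, hcard⟩ := D.exists_trace_multiplicative hX
  rcases Nat.eq_zero_or_pos (∑ i, b i) with hb | hb
  · right
    refine ⟨fun g => a g, ?_⟩
    rw [hab]
    have : ∀ i, b i = 0 := fun i => Finset.sum_eq_zero_iff.1 hb i (Finset.mem_univ i)
    simp [this]
  · left
    have : Nonempty N := ⟨n₀⟩
    have hN : 0 < Fintype.card N := Fintype.card_pos
    rw [hι] at hcard
    have hb1 : ∑ i, b i = 1 := by
      have : Fintype.card N * ∑ i, b i ≤ Fintype.card N * 1 := by omega
      have := Nat.le_of_mul_le_mul_left this hN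
      omega
    have ha : ∀ g, a g = 0 := by
      rw [hb1] at hcard
      have : ∑ g, a g = 0 := by omega
      exact fun g => Finset.sum_eq_zero_iff.1 this g (Finset.mem_univ g)
    obtain ⟨i, hi⟩ : ∃ i, b i ≠ 0 := by
      by_contra! h
      simp [h] at hb
    refine ⟨i, ?_⟩
    have hsum := Finset.add_sum_erase Finset.univ b (Finset.mem_univ i)
    have hbi : b i = 1 := by omega
    have hrest : ∀ j, j ≠ i → b j = 0 := fun j hj => by
      have : ∑ x ∈ Finset.univ.erase i, b x = 0 := by omega
      exact Finset.sum_eq_zero_iff.1 this j (by simp [hj])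
    rw [hab, Finset.sum_eq_single i (fun j _ hj => by simp [hrest j hj]) (by simp), hbi]
    simp [ha]

theorem exists_groupLike_mul_v (g : GroupLike k H) (i : I) : ∃ j, (g : H) * D.v i = D.v j := by
  have hX := (isMultiplicative_groupLike g).mul (D.mult i)
  have ht := IsMultiplicative.trace_mul (X := fun _ _ : Unit => (g : H)) (Y := D.T i)
  simp only [Finset.univ_unique, Finset.sum_singleton] at ht
  rcases D.exists_eq_v_or_mem_span hX (by simp) with ⟨j, hj⟩ | ⟨a, ha⟩
  · exact ⟨j, ht.symm.trans hj⟩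
  · have h1 : (g : H) * D.v i = ∑ h, a h • (h : H) := ht.symm.trans ha
    have h2 : D.v i = ∑ h, a h • ((g⁻¹ * h : GroupLike k H) : H) := by
      rw [← one_mul (D.v i), ← GroupLike.val_one (R := k), ← inv_mul_cancel g, GroupLike.val_mul,
        mul_assoc, h1, Finset.mul_sum]
      simp
    have h3 := D.η_v i i
    rw [h2, map_sum, Finset.sum_eq_zero fun h _ => by
      rw [map_smul, D.η_groupLike, smul_zero], if_pos rfl] at h3
    exact absurd h3 zero_ne_one

theorem exists_v_mul_groupLike (g : GroupLike k H) (i : I) : ∃ j, D.v i * (g : H) = D.v j := by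
  have hX := (D.mult i).mul (isMultiplicative_groupLike g)
  have ht := IsMultiplicative.trace_mul (X := D.T i) (Y := fun _ _ : Unit => (g : H))
  simp only [Finset.univ_unique, Finset.sum_singleton] at ht
  rcases D.exists_eq_v_or_mem_span hX (by simp) with ⟨j, hj⟩ | ⟨a, ha⟩
  · exact ⟨j, ht.symm.trans hj⟩
  · have h1 : D.v i * (g : H) = ∑ h, a h • (h : H) := ht.symm.trans ha
    have h2 : D.v i = ∑ h, a h • ((h * g⁻¹ : GroupLike k H) : H) := by
      rw [← mul_one (D.v i), ← GroupLike.val_one (R := k), ← mul_inv_cancel g, GroupLike.val_mul,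
        ← mul_assoc, h1, Finset.sum_mul]
      simp
    have h3 := D.η_v i i
    rw [h2, map_sum, Finset.sum_eq_zero fun h _ => by
      rw [map_smul, D.η_groupLike, smul_zero], if_pos rfl] at h3
    exact absurd h3 zero_ne_one

theorem d_mul (g h : GroupLike k H) : D.d (g * h) = D.d h := by
  have h1 := D.ε_χ (g * h)
  rw [← D.groupLike_mul_χ g, χ, mul_add, Finset.mul_sum, Finset.mul_sum, map_add, map_sum,
    map_sum] at h1
  have h2 : ∀ i, D.ε (g * h) ((g : H) * D.v i) = 0 := fun i => by
    obtain ⟨j, hj⟩ := D.exists_groupLike_mul_v g i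
    rw [hj, D.ε_v]
  simp only [mul_smul_comm, map_smul, h2, smul_zero, Finset.sum_const_zero, add_zero,
    ← GroupLike.val_mul, D.ε_groupLike, mul_right_inj] at h1
  simpa using h1.symm

theorem d_eq (g : GroupLike k H) : D.d g = D.d 1 := by
  simpa using D.d_mul g 1

theorem c_eq_of_mul {g : GroupLike k H} {i j : I} (h : (g : H) * D.v i = D.v j) :
    D.c j = D.c i := by
  have hg : ((g⁻¹ : GroupLike k H) : H) * g = 1 := by
    rw [← GroupLike.val_mul, inv_mul_cancel, GroupLike.val_one]
  have hl : ∀ l, D.η j ((g : H) * D.v l) = if l = i then 1 else 0 := fun l => by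
    obtain ⟨m, hm⟩ := D.exists_groupLike_mul_v g l
    rw [hm, D.η_v]
    refine if_congr ⟨fun hmj => ?_, fun hli => ?_⟩ rfl rfl
    · refine D.v_injective ?_
      rw [← one_mul (D.v l), ← one_mul (D.v i), ← hg, mul_assoc, mul_assoc, hm, h, hmj]
    · exact D.v_injective (by rw [← hm, hli, h])
  have h1 := D.η_χ j
  rw [← D.groupLike_mul_χ g, χ, mul_add, Finset.mul_sum, Finset.mul_sum, map_add, map_sum,
    map_sum] at h1
  simp only [mul_smul_comm, map_smul, ← GroupLike.val_mul, D.η_groupLike, smul_zero,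
    Finset.sum_const_zero, zero_add, hl] at h1
  simpa using h1.symm

/-- Fusion coefficients of the characters. -/
theorem exists_fusion (i j : I) : ∃ (a : GroupLike k H → ℕ) (b : I → ℕ),
    D.v i * D.v j = ∑ g, (a g : k) • (g : H) + ∑ l, (b l : k) • D.v l ∧
      Fintype.card N * Fintype.card N = ∑ g, a g + Fintype.card N * ∑ l, b l := by
  obtain ⟨a, b, hab, hcard⟩ := D.exists_trace_multiplicative ((D.mult i).mul (D.mult j))
  refine ⟨a, b, ?_, by rw [← hcard, Fintype.card_prod]⟩
  rw [← hab, v, v, ← IsMultiplicative.trace_mul]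

/-- The multiplicity of the grouplike `g` in the product of the characters `v i` and `v j`. -/
noncomputable def fusion (i j : I) : GroupLike k H → ℕ := (D.exists_fusion i j).choose

theorem fusion_spec (i j : I) : ∃ b : I → ℕ,
    D.v i * D.v j = ∑ g, (D.fusion i j g : k) • (g : H) + ∑ l, (b l : k) • D.v l ∧
      Fintype.card N * Fintype.card N = ∑ g, D.fusion i j g + Fintype.card N * ∑ l, b l :=
  (D.exists_fusion i j).choose_spec

theorem ε_v_mul_v (i j : I) (g : GroupLike k H) : D.ε g (D.v i * D.v j) = D.fusion i j g := by
  obtain ⟨b, hb, -⟩ := D.fusion_spec i j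
  rw [hb]
  simp [D.ε_groupLike, D.ε_v]

theorem card_dvd_sum_fusion (i j : I) : Fintype.card N ∣ ∑ g, D.fusion i j g := by
  obtain ⟨b, -, hb⟩ := D.fusion_spec i j
  exact (Nat.dvd_add_left (Dvd.intro _ rfl)).1 (Dvd.intro _ hb)

theorem sum_fusion_le (i j : I) : ∑ g, D.fusion i j g ≤ Fintype.card N * Fintype.card N := by
  obtain ⟨b, -, hb⟩ := D.fusion_spec i j
  omega

theorem sum_c_mul_fusion (i : I) (g : GroupLike k H) :
    ∑ j, D.c j * D.fusion i j g = Fintype.card N * D.d g := by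
  have h := congrArg (D.ε g) (D.v_mul_χ i)
  rw [map_smul, D.ε_χ, χ, mul_add, Finset.mul_sum, Finset.mul_sum, map_add, map_sum,
    map_sum] at h
  have h2 : ∀ l : GroupLike k H, D.ε g (D.v i * (l : H)) = 0 := fun l => by
    obtain ⟨j, hj⟩ := D.exists_v_mul_groupLike l i
    rw [hj, D.ε_v]
  simp only [mul_smul_comm, map_smul, h2, D.ε_v_mul_v, smul_eq_mul, mul_zero,
    Finset.sum_const_zero, zero_add] at h
  exact_mod_cast h

theorem fusion_mul {g : GroupLike k H} {i : I} (hg : (g : H) * D.v i = D.v i) (j : I)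
    (h : GroupLike k H) : D.fusion i j (g * h) = D.fusion i j h := by
  have h1 := D.ε_v_mul_v i j (g * h)
  obtain ⟨b, hb, -⟩ := D.fusion_spec i j
  have h2 : ∀ l, D.ε (g * h) ((g : H) * D.v l) = 0 := fun l => by
    obtain ⟨m, hm⟩ := D.exists_groupLike_mul_v g l
    rw [hm, D.ε_v]
  rw [← hg, mul_assoc, hb, mul_add, Finset.mul_sum, Finset.mul_sum, map_add, map_sum,
    map_sum] at h1
  simp only [mul_smul_comm, map_smul, h2, smul_zero, Finset.sum_const_zero, add_zero,
    ← GroupLike.val_mul, D.ε_groupLike, mul_right_inj] at h1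
  simpa using h1.symm

end MatrixCoradical

namespace MatrixCoradical

variable {k H I N : Type*} [Field k] [CharZero k] [Ring H] [HopfAlgebra k H]
  [FiniteDimensional k H] [DecidableEq I] [Fintype I] [Fintype N] [DecidableEq N]
  [DecidableEq (GroupLike k H)] [Fintype (GroupLike k H)] {n₀ : N}
  (D : MatrixCoradical k H I N n₀)

theorem eq_one_of_mul_v (hp : (Fintype.card (GroupLike k H)).Prime)
    (hlt : Fintype.card N < Fintype.card (GroupLike k H)) {g : GroupLike k H} {i : I}
    (hg : (g : H) * D.v i = D.v i) : g = 1 := by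
  by_contra hne
  have hN : 0 < Fintype.card N := Fintype.card_pos_iff.2 ⟨n₀⟩
  have : Fact (Fintype.card (GroupLike k H)).Prime := ⟨hp⟩
  have hconst : ∀ j h, D.fusion i j h = D.fusion i j 1 := fun j h => by
    obtain ⟨m, rfl⟩ := mem_powers_of_prime_card (g' := h) Nat.card_eq_fintype_card hne
    induction m with
    | zero => simp
    | succ m ih => simpa only [pow_succ', D.fusion_mul hg] using ih
  have hzero : ∀ j, D.fusion i j 1 = 0 := fun j => by
    have h1 := D.card_dvd_sum_fusion i j
    have h2 := D.sum_fusion_le i j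
    simp only [hconst j, Finset.sum_const, Finset.card_univ, smul_eq_mul] at h1 h2
    by_contra h0
    have h3 := Nat.le_of_dvd (Nat.pos_of_ne_zero h0)
      ((Nat.coprime_of_lt_prime hN.ne' hlt hp).symm.dvd_of_dvd_mul_left h1)
    have h4 := Nat.mul_le_mul_left (Fintype.card (GroupLike k H)) h3
    have h5 := Nat.mul_lt_mul_of_pos_right hlt hN
    omega
  have h := D.sum_c_mul_fusion i 1
  simp only [hzero, mul_zero, Finset.sum_const_zero] at h
  exact (Nat.mul_pos hN (D.d_pos 1)).ne h

include D in
theorem false_of_card {p s : ℕ} (hp : p.Prime) (hp7 : 7 ≤ p) (hs : 1 ≤ s)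
    (hG : Fintype.card (GroupLike k H) = p) (hN : Fintype.card N + 2 = p)
    (hI : Fintype.card I = s * p) (hdim : Module.finrank k H = p ^ 3) : False := by
  have hsum := D.finrank_eq_sum
  set n := Fintype.card N with hn
  have hd : ∑ g, D.d g = p * D.d 1 := by
    simp only [D.d_eq, Finset.sum_const, Finset.card_univ, smul_eq_mul, hG]
  have hd1 := D.d_pos 1
  have hsq : p ^ 2 ≤ 2 * n ^ 2 := by
    subst hN
    nlinarith
  have hs1 : s = 1 := by
    have h1 : s * p * n ≤ ∑ i, D.c i := by
      rw [← hI, ← Finset.card_univ, ← smul_eq_mul]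
      exact Finset.card_nsmul_le_sum _ _ _ fun i _ => by rw [D.c_eq_add]; exact Nat.le_add_right _ _
    by_contra h
    have hs2 : 2 ≤ s := by omega
    have h2 : p ^ 3 ≤ n * (s * p * n) := by
      calc p ^ 3 = p * p ^ 2 := by ring
        _ ≤ p * (2 * n ^ 2) := Nat.mul_le_mul_left _ hsq
        _ = 2 * (p * n ^ 2) := by ring
        _ ≤ s * (p * n ^ 2) := Nat.mul_le_mul_right _ hs2
        _ = _ := by ring
    have h3 := Nat.mul_le_mul_left n h1
    rw [hdim, hd] at hsum
    have h4 : 0 < p * D.d 1 := Nat.mul_pos hp.pos hd1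
    omega
  rw [hs1, one_mul] at hI
  obtain ⟨i₀⟩ : Nonempty I := Fintype.card_pos_iff.1 (hI ▸ hp.pos)
  choose σ hσ using fun g => D.exists_groupLike_mul_v g i₀
  have hσinj : Function.Injective σ := fun g h hgh => by
    have h1 : ((h⁻¹ * g : GroupLike k H) : H) * D.v i₀ = D.v i₀ := by
      rw [GroupLike.val_mul, mul_assoc, hσ, hgh, ← hσ, ← mul_assoc, ← GroupLike.val_mul,
        inv_mul_cancel, GroupLike.val_one, one_mul]
    exact (inv_mul_eq_one.1 (D.eq_one_of_mul_v (hG ▸ hp) (by omega) h1)).symm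
  have hσbij := (Fintype.bijective_iff_injective_and_card σ).2 ⟨hσinj, hG.trans hI.symm⟩
  have hc0 : ∀ i, D.c i = D.c i₀ := fun i => by
    obtain ⟨g, rfl⟩ := hσbij.2 i
    exact D.c_eq_of_mul (hσ g)
  have hcsum : ∑ i, D.c i = p * D.c i₀ := by
    simp only [hc0, Finset.sum_const, Finset.card_univ, smul_eq_mul, hI]
  have hsum' : p ^ 2 = D.d 1 + n * D.c i₀ := by
    rw [hdim, hd, hcsum] at hsum
    refine Nat.eq_of_mul_eq_mul_left hp.pos ?_
    linarith [pow_succ p 2]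
  have hclt : D.c i₀ < 2 * n := by
    by_contra! h
    nlinarith [Nat.mul_le_mul_left n h]
  have : Nontrivial N := Fintype.one_lt_card_iff_nontrivial.1 (by omega)
  obtain ⟨b, hb⟩ := exists_ne n₀
  have hc : ∀ i, D.c i = n := fun i => D.c_eq_card_of_lt hb (by rw [hc0]; exact hclt)
  have hdvd : n ∣ p * D.d 1 := by
    have h1 : ∑ g, ∑ j, D.c j * D.fusion i₀ j g = n * (p * D.d 1) := by
      simp only [D.sum_c_mul_fusion, ← Finset.mul_sum, hd, hn]
    rw [Finset.sum_comm] at h1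
    simp only [hc, ← Finset.mul_sum] at h1
    rw [← Nat.eq_of_mul_eq_mul_left (by omega) h1]
    exact Finset.dvd_sum fun j _ => D.card_dvd_sum_fusion i₀ j
  have hdvd' : n ∣ p ^ 3 := by
    rw [← hdim, hsum, hd]
    exact dvd_add hdvd (Dvd.intro _ rfl)
  have hcop : Nat.Coprime p n := Nat.coprime_of_lt_prime (by omega) (by omega) hp
  have := (hcop.symm.pow_right 3).eq_one_of_dvd hdvd'
  omega

end MatrixCoradical

section Grouplikes

variable {k H : Type*} [Field k] [AddCommGroup H] [Module k H] [Coalgebra k H]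

theorem range_groupLike_val :
    Set.range (GroupLike.val (R := k) (A := H)) = grouplikes k H := by
  ext g
  refine ⟨?_, fun ⟨hg0, hg⟩ => ?_⟩
  · rintro ⟨g, rfl⟩
    exact ⟨g.2.ne_zero, g.2.comul_eq_tmul_self⟩
  · have h1 := Coalgebra.rTensor_counit_comul (R := k) g
    rw [show comul g = g ⊗ₜ[k] g from hg, LinearMap.rTensor_tmul] at h1
    have h2 : counit (R := k) g • g = (1 : k) • g := by
      simpa using congrArg (TensorProduct.lid k H) h1
    exact ⟨⟨g, smul_left_injective k hg0 h2, hg⟩, rfl⟩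

theorem linearIndependent_groupLike_sum {I ι : Type*} {C : I → Submodule k H} {T : I → ι → H}
    (hli : ∀ i, LinearIndependent k (T i))
    (hspan : ∀ i, C i = Submodule.span k (Set.range (T i)))
    (hindep : iSupIndep fun i : Option I => i.elim (Submodule.span k (grouplikes k H)) C) :
    LinearIndependent k (Sum.elim (GroupLike.val (R := k) (A := H))
      fun x : Σ _ : I, ι => T x.1 x.2) := by
  refine linearIndep_groupLikeVal.sum_type (linearIndependent_iUnion_finite hli fun i t _ hi => ?_)
    ((hindep none).mono (by rw [range_groupLike_val]; rfl) ?_)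
  · have h : iSupIndep C := hindep.comp (Option.some_injective I)
    simpa only [← hspan] using h.disjoint_biSup hi
  · rw [Submodule.span_le]
    rintro _ ⟨⟨i, x⟩, rfl⟩
    refine (le_iSup₂_of_le (some i) (Option.some_ne_none i) le_rfl : C i ≤ _) ?_
    rw [hspan]
    exact Submodule.subset_span ⟨x, rfl⟩

end Grouplikes

end HopfClass

open HopfClass in
/-- Let `p ≥ 7` be a prime and `H` a nonsemisimple, nonpointed, non-copointed Hopf algebra of
dimension `p³`. Then for every `s ≥ 1` the coradical `H₀` is not isomorphic as a coalgebra to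
`kC_p ⊕ M*(p−2,k)^{sp}`. -/
theorem coradical_ne_group_plus_matrix_p_sub_two_copies
    (k : Type*) [Field k] [IsAlgClosed k] [CharZero k]
    (H : Type*) [Ring H] [HopfAlgebra k H] [FiniteDimensional k H]
    (p : ℕ) (hp : p.Prime) (hodd : Odd p) (hp7 : 7 ≤ p)
    (hdim : Module.finrank k H = p ^ 3)
    (hnss : ¬ IsSemisimpleRing H) (hnp : ¬ IsPointed k H) (hncop : ¬ IsCopointed k H)
    (hG : (grouplikes k H).ncard = p)
    (s : ℕ) (hs : 1 ≤ s)
    (C : Fin (s * p) → Submodule k H)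
    (hC : ∀ i, IsMatrixSubcoalg k H (p - 2) (C i))
    (hindep : iSupIndep (fun i : Option (Fin (s * p)) =>
      i.elim (Submodule.span k (grouplikes k H)) C))
    (hsup : coradical k H = Submodule.span k (grouplikes k H) ⊔ ⨆ i, C i) :
    False := by
  classical
  choose T hli hspan hcomul hcounit using hC
  have hcard : Nat.card (GroupLike k H) = p := by
    rw [← hG, ← range_groupLike_val, Set.ncard_range_of_injective GroupLike.val_injective]
  have : Finite (GroupLike k H) := Nat.finite_of_card_ne_zero (hcard ▸ hp.ne_zero)
  have := Fintype.ofFinite (GroupLike k H)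
  have mult : ∀ i, IsMultiplicative (k := k) (T i) := fun i => ⟨hcomul i, hcounit i⟩
  have ker_le : ∀ f, coradicalRep T mult f = 0 → f ∈ Ring.jacobson (ConvDual k H) := by
    refine fun f hf => mem_jacobson_of_vanish_coradical ?_
    suffices h : coradical k H ≤ LinearMap.ker f.ofConv from fun x hx => h hx
    rw [hsup, sup_le_iff, iSup_le_iff, Submodule.span_le, ← range_groupLike_val]
    refine ⟨?_, fun i => ?_⟩
    · rintro _ ⟨g, rfl⟩
      exact congrFun (congrArg Prod.fst hf) g
    · rw [hspan i, Submodule.span_le]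
      rintro _ ⟨x, rfl⟩
      exact congrFun (congrFun (congrFun (congrArg Prod.snd hf) i) x.1) x.2
  obtain ⟨D⟩ := nonempty_matrixCoradical (⟨0, by omega⟩ : Fin (p - 2)) mult
    (coradicalRep_surjective mult (linearIndependent_groupLike_sum hli hspan hindep)) ker_le
  exact D.false_of_card hp hp7 hs (Nat.card_eq_fintype_card.symm.trans hcard)
    (by rw [Fintype.card_fin]; omega) (Fintype.card_fin _) hdim
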